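/- Let q be a prime power, N ≥ 3, and let X = F_q^N. Let ρ, ℓ, s be integers with 2 ≤ ρ ≤ N, ρ ≤ ℓ ≤ (q^ρ−1)/(q−1), and 1 ≤ s ≤ N, and let V ≤ X be a subspace of dimension s. Then the number of sets P of ℓ one-dimensional F_q-subspaces of X such that the span of the elements of P has dimension ρ and no element of P is contained in V equals λ_q(N, s, ℓ, ρ) = Σ_{i=0}^{ρ} (−1)^{ρ−i} · q^{C(ρ−i, 2)} · [N−i choose ρ−i]_q · Σ_{t=0}^{min(s,i)} C((q^i−q^t)/(q−1), ℓ) · [s choose t]_q · [N−s choose i−t]_q · q^{(s−t)(i−t)}. -/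

import Mathlib

/-- The q-binomial (Gaussian) coefficient `[i choose j]_q`, as a rational number, via the
product formula `∏_{l=0}^{j−1} (q^i−q^l)/(q^j−q^l)` (it equals `0` when `j > i`). -/
def qBin (q i j : ℕ) : ℚ :=
  ∏ l ∈ Finset.range j, ((q : ℚ) ^ i - q ^ l) / ((q : ℚ) ^ j - q ^ l)

/-- The product `∏_{l<n} (q^{l+1} - 1)`, an unnormalised `q`-factorial. -/
def qFac (q n : ℕ) : ℚ := ∏ l ∈ Finset.range n, ((q : ℚ) ^ (l + 1) - 1)

theorem qFac_succ (q n : ℕ) : qFac q (n + 1) = qFac q n * ((q : ℚ) ^ (n + 1) - 1) :=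
  Finset.prod_range_succ _ _

theorem qFac_ne_zero {q : ℕ} (hq : 1 < q) (n : ℕ) : qFac q n ≠ 0 := by
  refine Finset.prod_ne_zero_iff.2 fun l _ => ?_
  have h : (1 : ℚ) < (q : ℚ) ^ (l + 1) := one_lt_pow₀ (by exact_mod_cast hq) (by omega)
  exact (sub_pos.2 h).ne'

theorem prod_pow_sub_pow_mul_qFac (q j m : ℕ) :
    (∏ l ∈ Finset.range j, ((q : ℚ) ^ (j + m) - q ^ l)) * qFac q m =
      (q : ℚ) ^ j.choose 2 * qFac q (j + m) := by
  induction j generalizing m with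
  | zero => simp
  | succ j ih =>
    have h := ih (m + 1)
    rw [qFac_succ] at h
    rw [Finset.prod_range_succ, Nat.choose_succ_succ' j 1, Nat.choose_one_right,
      show j + 1 + m = j + (m + 1) by ring, pow_add (q : ℚ) j (j.choose 2)]
    linear_combination (q : ℚ) ^ j * h

theorem qBin_add_left {q : ℕ} (hq : 1 < q) (j m : ℕ) :
    qBin q (j + m) j = qFac q (j + m) / (qFac q j * qFac q m) := by
  have h0 := prod_pow_sub_pow_mul_qFac q j 0
  have hm := prod_pow_sub_pow_mul_qFac q j m
  have hj := qFac_ne_zero hq j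
  have hm' := qFac_ne_zero hq m
  have hq0 : (q : ℚ) ≠ 0 := by exact_mod_cast (by omega : q ≠ 0)
  have h1 : qFac q 0 = 1 := by simp [qFac]
  rw [h1, mul_one, add_zero] at h0
  rw [qBin, Finset.prod_div_distrib, h0, eq_div_of_mul_eq hm' hm]
  field_simp

theorem qBin_eq_zero {q i j : ℕ} (h : i < j) : qBin q i j = 0 :=
  Finset.prod_eq_zero (Finset.mem_range.2 h) (by simp)

theorem qBin_zero_right (q n : ℕ) : qBin q n 0 = 1 := by simp [qBin]

theorem qBin_self {q : ℕ} (hq : 1 < q) (n : ℕ) : qBin q n n = 1 := by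
  have h := qBin_add_left hq n 0
  have h1 : qFac q 0 = 1 := by simp [qFac]
  rwa [h1, mul_one, add_zero, div_self (qFac_ne_zero hq n)] at h

theorem qBin_succ_succ {q : ℕ} (hq : 1 < q) (n m : ℕ) :
    qBin q (n + 1) (m + 1) = qBin q n m + (q : ℚ) ^ (m + 1) * qBin q n (m + 1) := by
  rcases lt_trichotomy n m with h | rfl | h
  · simp [qBin_eq_zero h, qBin_eq_zero (Nat.lt_succ_of_lt h), qBin_eq_zero (Nat.succ_lt_succ h)]
  · simp [qBin_self hq, qBin_eq_zero (Nat.lt_succ_self n)]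
  · obtain ⟨k, rfl⟩ := Nat.exists_eq_add_of_lt h
    have e1 := qBin_add_left hq (m + 1) (k + 1)
    have e2 := qBin_add_left hq m (k + 1)
    have e3 := qBin_add_left hq (m + 1) k
    rw [show m + 1 + (k + 1) = m + k + 1 + 1 by ring] at e1
    rw [show m + (k + 1) = m + k + 1 by ring] at e2
    rw [show m + 1 + k = m + k + 1 by ring] at e3
    rw [e1, e2, e3, qFac_succ q (m + k + 1), qFac_succ q m, qFac_succ q k]
    have := qFac_ne_zero hq m
    have := qFac_ne_zero hq k
    have hm : (q : ℚ) ^ (m + 1) - 1 ≠ 0 := fun h0 => by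
      have := qFac_ne_zero hq (m + 1)
      rw [qFac_succ, h0, mul_zero] at this
      exact this rfl
    have hk : (q : ℚ) ^ (k + 1) - 1 ≠ 0 := fun h0 => by
      have := qFac_ne_zero hq (k + 1)
      rw [qFac_succ, h0, mul_zero] at this
      exact this rfl
    rw [show (q : ℚ) ^ (m + k + 1 + 1) = q ^ (m + 1) * q ^ (k + 1) by ring]
    generalize (q : ℚ) ^ (m + 1) = a at *
    generalize (q : ℚ) ^ (k + 1) = b at *
    field_simp
    ring

theorem sum_range_alternating_qBin {q : ℕ} (hq : 1 < q) (n m : ℕ) :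
    ∑ k ∈ Finset.range (m + 1), (-1 : ℚ) ^ k * (q : ℚ) ^ k.choose 2 * qBin q (n + 1) k =
      (-1) ^ m * (q : ℚ) ^ (m + 1).choose 2 * qBin q n m := by
  induction m with
  | zero => simp [qBin_zero_right]
  | succ m ih =>
    rw [Finset.sum_range_succ, ih, qBin_succ_succ hq, Nat.choose_succ_succ' (m + 1) 1,
      Nat.choose_one_right, pow_add (q : ℚ) (m + 1)]
    ring

theorem sum_alternating_qBin {q : ℕ} (hq : 1 < q) (n : ℕ) :
    ∑ k ∈ Finset.range (n + 1), (-1 : ℚ) ^ k * (q : ℚ) ^ k.choose 2 * qBin q n k =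
      if n = 0 then 1 else 0 := by
  cases n with
  | zero => simp [qBin_zero_right]
  | succ n => rw [sum_range_alternating_qBin hq, qBin_eq_zero n.lt_succ_self]; simp

theorem qBin_mul_qBin {q : ℕ} (hq : 1 < q) (a b c : ℕ) :
    qBin q (a + b + c) a * qBin q (b + c) b =
      qBin q (a + b + c) (a + b) * qBin q (a + b) b := by
  have e1 := qBin_add_left hq a (b + c)
  have e2 := qBin_add_left hq b a
  rw [← add_assoc] at e1
  rw [add_comm b a] at e2
  rw [e1, e2, qBin_add_left hq b c, qBin_add_left hq (a + b) c]
  have := qFac_ne_zero hq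
  field_simp [this a, this b, this c, this (a + b), this (b + c)]

open Module

section Flags

variable {F E : Type*} [Field F] [AddCommGroup E] [Module F E]

/-- Pairs of tuples `(v, u)` with `v` linearly independent in `V` and `u` linearly independent
modulo `V`. -/
def AdaptedTuples (V : Submodule F E) (t m : ℕ) : Type _ :=
  {v : Fin t → V // LinearIndependent F v} × {u : Fin m → E // LinearIndependent F (V.mkQ ∘ u)}

namespace AdaptedTuples

variable {V : Submodule F E} {t m : ℕ}

/-- The subspace spanned by both tuples. -/
def span (p : AdaptedTuples V t m) : Submodule F E :=
  Submodule.span F (Set.range fun j => (p.1.1 j : E)) ⊔ Submodule.span F (Set.range p.2.1)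

theorem finrank_span (p : AdaptedTuples V t m) : finrank F p.span = t + m := by
  have h := finrank_span_eq_card (p.1.2.sumElim_of_quotient p.2.1 p.2.2)
  rw [Set.Sum.elim_range, Submodule.span_union, Fintype.card_sum, Fintype.card_fin,
    Fintype.card_fin] at h
  exact h

theorem span_inf (p : AdaptedTuples V t m) :
    p.span ⊓ V = Submodule.span F (Set.range fun j => (p.1.1 j : E)) := by
  have hle : Submodule.span F (Set.range fun j => (p.1.1 j : E)) ≤ V :=
    Submodule.span_le.2 (Set.range_subset_iff.2 fun j => (p.1.1 j).2)
  have hd := Submodule.range_ker_disjoint p.2.2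
  rw [Submodule.ker_mkQ] at hd
  rw [span, sup_inf_assoc_of_le _ hle, hd.eq_bot, sup_bot_eq]

theorem finrank_span_inf (p : AdaptedTuples V t m) : finrank F ↥(p.span ⊓ V) = t := by
  rw [span_inf]
  exact (finrank_span_eq_card (p.1.2.map' V.subtype V.ker_subtype)).trans (Fintype.card_fin t)

theorem linearIndependent_mkQ_submoduleOf_iff (V W : Submodule F E) (u : Fin m → W) :
    LinearIndependent F ((V.submoduleOf W).mkQ ∘ u) ↔
      LinearIndependent F (V.mkQ ∘ fun j => (u j : E)) := by
  have h : V.submoduleOf W ≤ V.comap W.subtype := le_of_eq rfl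
  rw [← LinearMap.linearIndependent_iff ((V.submoduleOf W).mapQ V W.subtype h)]
  · rfl
  · rw [Submodule.ker_mapQ]
    exact Submodule.mkQ_map_self _

/-- Adapted tuples inside `W`, viewed in the ambient space. -/
def ofSubmodule (W : Submodule F E) (p : AdaptedTuples (V.submoduleOf W) t m) :
    AdaptedTuples V t m :=
  (⟨fun j => ⟨((p.1.1 j : W) : E), (p.1.1 j).2⟩, by
      refine LinearIndependent.of_comp V.subtype ?_
      exact p.1.2.map' (W.subtype ∘ₗ (V.submoduleOf W).subtype)
        (LinearMap.ker_eq_bot.2 (W.subtype_injective.comp (Submodule.subtype_injective _)))⟩,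
    ⟨fun j => (p.2.1 j : E), (linearIndependent_mkQ_submoduleOf_iff V W p.2.1).1 p.2.2⟩)

theorem span_ofSubmodule_le (W : Submodule F E) (p : AdaptedTuples (V.submoduleOf W) t m) :
    (ofSubmodule W p).span ≤ W :=
  sup_le (Submodule.span_le.2 (Set.range_subset_iff.2 fun j => (p.1.1 j : W).2))
    (Submodule.span_le.2 (Set.range_subset_iff.2 fun j => (p.2.1 j).2))

theorem ofSubmodule_injective (W : Submodule F E) :
    Function.Injective (ofSubmodule (V := V) (t := t) (m := m) W) := by
  intro p p' h
  refine Prod.ext (Subtype.ext (funext fun j => ?_)) (Subtype.ext (funext fun j => ?_))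
  · exact Subtype.ext (Subtype.ext
      (congrArg (fun r : AdaptedTuples V t m => (r.1.1 j : E)) h))
  · exact Subtype.ext (congrArg (fun r : AdaptedTuples V t m => r.2.1 j) h)

theorem exists_ofSubmodule_eq (p : AdaptedTuples V t m) : ∃ p', ofSubmodule p.span p' = p := by
  have h1 (j) : (p.1.1 j : E) ∈ p.span :=
    Submodule.mem_sup_left (Submodule.subset_span ⟨j, rfl⟩)
  have h2 (j) : p.2.1 j ∈ p.span := Submodule.mem_sup_right (Submodule.subset_span ⟨j, rfl⟩)
  refine ⟨(⟨fun j => ⟨⟨p.1.1 j, h1 j⟩, (p.1.1 j).2⟩, ?_⟩, ⟨fun j => ⟨p.2.1 j, h2 j⟩, ?_⟩), rfl⟩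
  · refine LinearIndependent.of_comp (p.span.subtype ∘ₗ (V.submoduleOf p.span).subtype) ?_
    exact p.1.2.map' V.subtype V.ker_subtype
  · exact (linearIndependent_mkQ_submoduleOf_iff V p.span _).2 p.2.2

theorem card_fiber [FiniteDimensional F E] (W : Submodule F E) (hW : finrank F W = t + m) :
    Nat.card {p : AdaptedTuples V t m // p.span = W} =
      Nat.card (AdaptedTuples (V.submoduleOf W) t m) := by
  refine (Nat.card_congr (Equiv.ofBijective
    (fun p => ⟨ofSubmodule W p, Submodule.eq_of_le_of_finrank_eq (span_ofSubmodule_le W p)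
      ((finrank_span _).trans hW.symm)⟩) ⟨fun p p' h => ?_, ?_⟩)).symm
  · exact ofSubmodule_injective W (congrArg Subtype.val h)
  · rintro ⟨p, rfl⟩
    obtain ⟨p', hp'⟩ := exists_ofSubmodule_eq p
    exact ⟨p', Subtype.ext hp'⟩

end AdaptedTuples

theorem card_linearIndependent_rat [Fintype F] [Finite E] (k : ℕ) :
    (Nat.card {v : Fin k → E // LinearIndependent F v} : ℚ) =
      ∏ l ∈ Finset.range k, ((Fintype.card F : ℚ) ^ finrank F E - (Fintype.card F : ℚ) ^ l) := by
  rcases le_or_gt k (finrank F E) with hk | hk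
  · rw [card_linearIndependent hk, Nat.cast_prod, ← Fin.prod_univ_eq_prod_range
      (fun l => (Fintype.card F : ℚ) ^ finrank F E - (Fintype.card F : ℚ) ^ l)]
    refine Finset.prod_congr rfl fun l _ => ?_
    rw [Nat.cast_sub (Nat.pow_le_pow_right Fintype.card_pos (l.2.le.trans hk))]
    simp
  · have : IsEmpty {v : Fin k → E // LinearIndependent F v} :=
      ⟨fun v => by simpa using (v.2.fintype_card_le_finrank.trans_lt hk)⟩
    rw [Finset.prod_eq_zero (Finset.mem_range.2 hk) (sub_self _)]
    simp

theorem card_linearIndependent_mkQ [Finite E] (V : Submodule F E) (m : ℕ) :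
    Nat.card {u : Fin m → E // LinearIndependent F (V.mkQ ∘ u)} =
      Nat.card {w : Fin m → E ⧸ V // LinearIndependent F w} * Nat.card V ^ m := by
  let e : E ≃ (E ⧸ V) × V :=
    AddSubgroup.addGroupEquivQuotientProdAddSubgroup (s := V.toAddSubgroup)
  let e' : (Fin m → E) ≃ (Fin m → E ⧸ V) × (Fin m → V) :=
    (Equiv.arrowCongr (Equiv.refl _) e).trans (Equiv.arrowProdEquivProdArrow _ _ _)
  have h : {u : Fin m → E // LinearIndependent F (V.mkQ ∘ u)} ≃
      {p : (Fin m → E ⧸ V) × (Fin m → V) // LinearIndependent F p.1} :=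
    e'.subtypeEquiv fun u => Iff.rfl
  rw [Nat.card_congr (h.trans
    (Equiv.prodSubtypeFstEquivSubtypeProd (p := fun w => LinearIndependent F w))), Nat.card_prod, Nat.card_fun,
    Nat.card_fin]

theorem AdaptedTuples.card [Fintype F] [Finite E] (V : Submodule F E) (t m : ℕ) :
    (Nat.card (AdaptedTuples V t m) : ℚ) =
      (∏ l ∈ Finset.range t, ((Fintype.card F : ℚ) ^ finrank F V - (Fintype.card F : ℚ) ^ l)) *
      ((∏ l ∈ Finset.range m,
        ((Fintype.card F : ℚ) ^ (finrank F E - finrank F V) - (Fintype.card F : ℚ) ^ l)) *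
        (Fintype.card F : ℚ) ^ (finrank F V * m)) := by
  have : Finite (E ⧸ V) := Finite.of_surjective _ V.mkQ_surjective
  rw [AdaptedTuples, Nat.card_prod, card_linearIndependent_mkQ, Nat.cast_mul, Nat.cast_mul,
    card_linearIndependent_rat, card_linearIndependent_rat, Submodule.finrank_quotient,
    Nat.cast_pow, Module.natCard_eq_pow_finrank (K := F) (V := V)]
  simp [pow_mul]

/-- The number of subspaces `W` of dimension `t + m` that meet `V` in dimension `t`. -/
theorem card_submodule_finrank_inf [Fintype F] [Finite E] (V : Submodule F E) (t m : ℕ) :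
    (Nat.card {W : Submodule F E // finrank F W = t + m ∧ finrank F ↥(W ⊓ V) = t} : ℚ) =
      qBin (Fintype.card F) (finrank F V) t *
        qBin (Fintype.card F) (finrank F E - finrank F V) m *
        (Fintype.card F : ℚ) ^ ((finrank F V - t) * m) := by
  have : Fintype {W : Submodule F E // finrank F W = t + m ∧ finrank F ↥(W ⊓ V) = t} :=
    Fintype.ofFinite _
  have hfin (V : Submodule F E) : Finite (AdaptedTuples V t m) :=
    inferInstanceAs (Finite ({v : Fin t → V // LinearIndependent F v} ×
      {u : Fin m → E // LinearIndependent F (V.mkQ ∘ u)}))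
  let f : AdaptedTuples V t m →
      {W : Submodule F E // finrank F W = t + m ∧ finrank F ↥(W ⊓ V) = t} :=
    fun p => ⟨p.span, p.finrank_span, p.finrank_span_inf⟩
  have key : (Nat.card (AdaptedTuples V t m) : ℚ) =
      ∑ W, (Nat.card {p // f p = W} : ℚ) := by
    rw [← Nat.card_congr (Equiv.sigmaFiberEquiv f), Nat.card_sigma, Nat.cast_sum]
  have hf (W) : (Nat.card {p // f p = W} : ℚ) =
      (∏ l ∈ Finset.range t, ((Fintype.card F : ℚ) ^ t - (Fintype.card F : ℚ) ^ l)) *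
      ((∏ l ∈ Finset.range m, ((Fintype.card F : ℚ) ^ m - (Fintype.card F : ℚ) ^ l)) *
        (Fintype.card F : ℚ) ^ (t * m)) := by
    have h1 : finrank F ↥(V.submoduleOf W.1) = t := by
      rw [← Submodule.finrank_map_subtype_eq, Submodule.submoduleOf,
        Submodule.map_comap_subtype]
      exact W.2.2
    have h2 := AdaptedTuples.card (V.submoduleOf W.1) t m
    rw [h1, W.2.1, Nat.add_sub_cancel_left] at h2
    rw [← h2, ← AdaptedTuples.card_fiber W.1 W.2.1]
    exact congrArg _ (Nat.card_congr (Equiv.subtypeEquivRight fun p => Subtype.ext_iff))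
  rw [AdaptedTuples.card, Finset.sum_congr rfl fun W _ => hf W, Finset.sum_const, nsmul_eq_mul,
    Finset.card_univ] at key
  rw [Nat.card_eq_fintype_card]
  have hq : 1 < Fintype.card F := Fintype.one_lt_card
  have hne (k : ℕ) :
      ∏ l ∈ Finset.range k, ((Fintype.card F : ℚ) ^ k - (Fintype.card F : ℚ) ^ l) ≠ 0 := by
    refine Finset.prod_ne_zero_iff.2 fun l hl => sub_ne_zero.2 (ne_of_gt ?_)
    exact pow_lt_pow_right₀ (by exact_mod_cast hq) (Finset.mem_range.1 hl)
  have hq0 : (Fintype.card F : ℚ) ≠ 0 := by exact_mod_cast (by omega : Fintype.card F ≠ 0)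
  rcases le_or_gt t (finrank F V) with ht | ht
  · have hp : (Fintype.card F : ℚ) ^ (finrank F V * m) =
        (Fintype.card F : ℚ) ^ (t * m) * (Fintype.card F : ℚ) ^ ((finrank F V - t) * m) := by
      rw [← pow_add, ← add_mul, Nat.add_sub_cancel' ht]
    rw [hp] at key
    rw [qBin, qBin, Finset.prod_div_distrib, Finset.prod_div_distrib]
    have h1 := hne t
    have h2 := hne m
    have h3 := pow_ne_zero (t * m) hq0
    field_simp
    refine mul_right_cancel₀ h3 ?_
    linear_combination -key
  · rw [qBin_eq_zero ht, zero_mul, zero_mul]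
    rw [Finset.prod_eq_zero (Finset.mem_range.2 ht) (sub_self _), zero_mul] at key
    exact (mul_eq_zero.1 key.symm).resolve_right
      (mul_ne_zero (hne t) (mul_ne_zero (hne m) (pow_ne_zero _ hq0)))

theorem finrank_inf_eq_right_iff [FiniteDimensional F E] (U W : Submodule F E) :
    finrank F ↥(W ⊓ U) = finrank F U ↔ U ≤ W :=
  ⟨fun h => inf_eq_right.1 (Submodule.eq_of_le_of_finrank_eq inf_le_right h),
    fun h => by rw [inf_eq_right.2 h]⟩

end Flags

theorem sum_qBin_mul_qBin {q : ℕ} (hq : 1 < q) {N ρ d : ℕ} (hρ : ρ ≤ N) :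
    ∑ i ∈ Finset.range (ρ + 1),
        (-1 : ℚ) ^ (ρ - i) * (q : ℚ) ^ Nat.choose (ρ - i) 2 * qBin q (N - i) (ρ - i) *
          (if d ≤ i then qBin q (N - d) (i - d) else 0) =
      if d = ρ then 1 else 0 := by
  rcases lt_or_ge ρ d with hd | hd
  · rw [if_neg hd.ne', Finset.sum_eq_zero]
    intro i hi
    rw [if_neg (by have := Finset.mem_range.1 hi; omega), mul_zero]
  · obtain ⟨n, rfl⟩ := Nat.exists_eq_add_of_le hd
    obtain ⟨c, rfl⟩ := Nat.exists_eq_add_of_le hρ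
    have h := sum_alternating_qBin hq n
    rw [← Finset.sum_flip, ← Finset.sum_subset (Finset.range_mono (by omega : n + 1 ≤ d + n + 1))]
    · have hterm : ∀ k ∈ Finset.range (n + 1),
          (-1 : ℚ) ^ (d + n - (d + n - k)) * (q : ℚ) ^ Nat.choose (d + n - (d + n - k)) 2 *
            qBin q (d + n + c - (d + n - k)) (d + n - (d + n - k)) *
            (if d ≤ d + n - k then qBin q (d + n + c - d) (d + n - k - d) else 0) =
          qBin q (n + c) n * ((-1 : ℚ) ^ k * (q : ℚ) ^ k.choose 2 * qBin q n k) := by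
        intro k hk
        obtain ⟨a, rfl⟩ := Nat.exists_eq_add_of_le' (Nat.lt_succ_iff.1 (Finset.mem_range.1 hk))
        rw [if_pos (by omega), show d + (a + k) - (d + (a + k) - k) = k by omega,
          show d + (a + k) + c - (d + (a + k) - k) = k + c by omega,
          show d + (a + k) + c - d = a + k + c by omega,
          show d + (a + k) - k - d = a by omega]
        linear_combination (-1 : ℚ) ^ k * (q : ℚ) ^ k.choose 2 * qBin_mul_qBin hq a k c
      rw [Finset.sum_congr rfl hterm, ← Finset.mul_sum, h]
      rcases Nat.eq_zero_or_pos n with rfl | hn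
      · simp [qBin_zero_right]
      · rw [if_neg hn.ne', if_neg (by omega), mul_zero]
    · intro k hk' hk
      rw [Finset.mem_range] at hk hk'
      rcases le_or_gt d (d + n - k) with h' | h'
      · omega
      · rw [if_neg (by omega), mul_zero]

section Counting

variable {F E : Type*} [Field F] [Fintype F] [AddCommGroup E] [Module F E] [Finite E]

theorem card_submodule_ge (U : Submodule F E) (i : ℕ) :
    (Nat.card {W : Submodule F E // finrank F W = i ∧ U ≤ W} : ℚ) =
      if finrank F U ≤ i then
        qBin (Fintype.card F) (finrank F E - finrank F U) (i - finrank F U) else 0 := by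
  split_ifs with h
  · have := card_submodule_finrank_inf U (finrank F U) (i - finrank F U)
    simp_rw [finrank_inf_eq_right_iff, Nat.add_sub_cancel' h] at this
    rw [this, qBin_self Fintype.one_lt_card]
    simp
  · have : IsEmpty {W : Submodule F E // finrank F W = i ∧ U ≤ W} :=
      ⟨fun W => h ((Submodule.finrank_mono W.2.2).trans_eq W.2.1)⟩
    simp

theorem card_lines_le (W : Submodule F E) :
    Nat.card {L : Submodule F E // finrank F L = 1 ∧ L ≤ W} * (Fintype.card F - 1) =
      Fintype.card F ^ finrank F W - 1 := by
  have h := card_submodule_finrank_inf W 1 0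
  have hiff (L : Submodule F E) : finrank F L = 1 + 0 ∧ finrank F ↥(L ⊓ W) = 1 ↔
      finrank F L = 1 ∧ L ≤ W := by
    refine and_congr_right fun hL => ?_
    rw [← finrank_inf_eq_right_iff L W, hL, inf_comm]
  simp_rw [hiff] at h
  have hq : 1 < Fintype.card F := Fintype.one_lt_card
  have hq' : (Fintype.card F : ℚ) - 1 ≠ 0 := sub_ne_zero.2 (by exact_mod_cast hq.ne')
  have hp : 1 ≤ Fintype.card F ^ finrank F W := Nat.one_le_pow _ _ (by omega)
  rw [← @Nat.cast_inj ℚ, Nat.cast_mul, h, Nat.cast_sub hq.le, Nat.cast_sub hp]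
  simp only [qBin, Finset.prod_range_one, Finset.prod_range_zero]
  simp [hq']

open Classical in
theorem card_lines_le_not_le [Fintype (Submodule F E)] (V W : Submodule F E) :
    (Finset.univ.filter fun L : Submodule F E => finrank F L = 1 ∧ L ≤ W ∧ ¬ L ≤ V).card =
      (Fintype.card F ^ finrank F W - Fintype.card F ^ finrank F ↥(W ⊓ V)) /
        (Fintype.card F - 1) := by
  have h1 := card_lines_le W
  have h2 := card_lines_le (W ⊓ V)
  rw [Nat.card_eq_fintype_card, Fintype.card_subtype] at h1 h2
  have h3 := Finset.card_filter_add_card_filter_not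
    (s := Finset.univ.filter fun L : Submodule F E => finrank F L = 1 ∧ L ≤ W) (fun L => L ≤ V)
  simp only [Finset.filter_filter, and_assoc, ← le_inf_iff] at h3
  rw [← h3, add_mul, h2] at h1
  have hq : 1 < Fintype.card F := Fintype.one_lt_card
  have hp : 1 ≤ Fintype.card F ^ finrank F ↥(W ⊓ V) := Nat.one_le_pow _ _ (by omega)
  have hp' : 1 ≤ Fintype.card F ^ finrank F W := Nat.one_le_pow _ _ (by omega)
  exact (Nat.div_eq_of_eq_mul_left (by omega) (by omega)).symm

open Classical in
theorem card_sets_of_lines_le [Fintype (Submodule F E)] (V W : Submodule F E) (ℓ : ℕ) :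
    (Finset.univ.filter fun P : Finset (Submodule F E) =>
      ((∀ L ∈ P, finrank F L = 1) ∧ P.card = ℓ ∧ ∀ L ∈ P, ¬ L ≤ V) ∧ P.sup id ≤ W).card =
      ((Fintype.card F ^ finrank F W - Fintype.card F ^ finrank F ↥(W ⊓ V)) /
        (Fintype.card F - 1)).choose ℓ := by
  rw [← card_lines_le_not_le V W, ← Finset.card_powersetCard]
  congr 1
  ext P
  simp only [Finset.mem_filter, Finset.mem_univ, true_and, Finset.mem_powersetCard,
    Finset.subset_iff, Finset.sup_le_iff, id]
  grind

open Classical in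
theorem sum_choose_mul_card_submodule [Fintype (Submodule F E)] (V : Submodule F E) (i ℓ : ℕ) :
    ∑ t ∈ Finset.range (min (finrank F V) i + 1),
        (Nat.choose ((Fintype.card F ^ i - Fintype.card F ^ t) / (Fintype.card F - 1)) ℓ : ℚ) *
          qBin (Fintype.card F) (finrank F V) t *
          qBin (Fintype.card F) (finrank F E - finrank F V) (i - t) *
          (Fintype.card F : ℚ) ^ ((finrank F V - t) * (i - t)) =
      ∑ P ∈ Finset.univ.filter fun P : Finset (Submodule F E) =>
          (∀ L ∈ P, finrank F L = 1) ∧ P.card = ℓ ∧ ∀ L ∈ P, ¬ L ≤ V,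
        if finrank F ↥(P.sup id) ≤ i then
          qBin (Fintype.card F) (finrank F E - finrank F ↥(P.sup id))
            (i - finrank F ↥(P.sup id)) else 0 := by
  have hmaps : ∀ W ∈ (Finset.univ.filter fun W : Submodule F E => finrank F W = i),
      finrank F ↥(W ⊓ V) ∈ Finset.range (min (finrank F V) i + 1) := by
    intro W hW
    rw [Finset.mem_range, Nat.lt_succ_iff, ← (Finset.mem_filter.1 hW).2]
    exact le_min (Submodule.finrank_mono inf_le_right) (Submodule.finrank_mono inf_le_left)
  calc
    _ = ∑ W ∈ Finset.univ.filter fun W : Submodule F E => finrank F W = i,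
        (((Fintype.card F ^ finrank F W - Fintype.card F ^ finrank F ↥(W ⊓ V)) /
          (Fintype.card F - 1)).choose ℓ : ℚ) := by
      rw [← Finset.sum_fiberwise_of_maps_to hmaps]
      refine Finset.sum_congr rfl fun t ht => ?_
      have hti : t ≤ i := by
        rw [Finset.mem_range] at ht
        omega
      have h := card_submodule_finrank_inf V t (i - t)
      rw [Nat.card_eq_fintype_card, Fintype.card_subtype, Nat.add_sub_cancel' hti] at h
      rw [mul_assoc, mul_assoc, ← mul_assoc (qBin _ _ t), ← h, Finset.filter_filter,
        Finset.sum_congr rfl (g := fun _ => (Nat.choose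
          ((Fintype.card F ^ i - Fintype.card F ^ t) / (Fintype.card F - 1)) ℓ : ℚ)),
        Finset.sum_const, nsmul_eq_mul, mul_comm]
      intro W hW
      rw [(Finset.mem_filter.1 hW).2.1, (Finset.mem_filter.1 hW).2.2]
    _ = ∑ W ∈ Finset.univ.filter fun W : Submodule F E => finrank F W = i, ∑ P ∈ Finset.univ.filter fun P : Finset (Submodule F E) =>
          (∀ L ∈ P, finrank F L = 1) ∧ P.card = ℓ ∧ ∀ L ∈ P, ¬ L ≤ V,
          if P.sup id ≤ W then (1 : ℚ) else 0 := by
      refine Finset.sum_congr rfl fun W _ => ?_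
      rw [Finset.sum_boole, Finset.filter_filter, card_sets_of_lines_le]
    _ = _ := by
      rw [Finset.sum_comm]
      refine Finset.sum_congr rfl fun P _ => ?_
      rw [Finset.sum_boole, Finset.filter_filter, ← card_submodule_ge, Nat.card_eq_fintype_card,
        Fintype.card_subtype]

end Counting

/-- Let `V ≤ X = F_q^N` have dimension `s`. The number of sets `P` of `ℓ` one-dimensional
subspaces of `X` whose span has dimension `ρ` and no element of which lies in `V` equals
`λ_q(N, s, ℓ, ρ) = Σ_{i=0}^{ρ} (−1)^{ρ−i} q^{C(ρ−i,2)} [N−i choose ρ−i]_q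
  Σ_{t=0}^{min(s,i)} C((q^i−q^t)/(q−1), ℓ) [s choose t]_q [N−s choose i−t]_q q^{(s−t)(i−t)}`. -/
theorem stmt14 (q N ρ ℓ s : ℕ) (F : Type) [Field F] [Fintype F] (hq : Fintype.card F = q)
    (hN : 3 ≤ N) (hρ1 : 2 ≤ ρ) (hρ2 : ρ ≤ N) (hℓ1 : ρ ≤ ℓ)
    (hℓ2 : ℓ ≤ (q ^ ρ - 1) / (q - 1)) (hs1 : 1 ≤ s) (hs2 : s ≤ N)
    (V : Submodule F (Fin N → F)) (hV : Module.finrank F V = s) :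
    (Nat.card {P : Finset (Submodule F (Fin N → F)) //
        (∀ L ∈ P, Module.finrank F L = 1) ∧ P.card = ℓ ∧
          Module.finrank F ↥(P.sup id) = ρ ∧ ∀ L ∈ P, ¬ L ≤ V} : ℚ) =
      ∑ i ∈ Finset.range (ρ + 1),
        (-1 : ℚ) ^ (ρ - i) * (q : ℚ) ^ Nat.choose (ρ - i) 2 * qBin q (N - i) (ρ - i) *
          ∑ t ∈ Finset.range (min s i + 1),
            (Nat.choose ((q ^ i - q ^ t) / (q - 1)) ℓ : ℚ) * qBin q s t *
              qBin q (N - s) (i - t) * (q : ℚ) ^ ((s - t) * (i - t)) := by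
  classical
  have : Fintype (Submodule F (Fin N → F)) := Fintype.ofFinite _
  have h (i : ℕ) := sum_choose_mul_card_submodule V i ℓ
  simp only [hq, hV, Module.finrank_fin_fun] at h
  simp_rw [h, Finset.mul_sum]
  rw [Finset.sum_comm, Finset.sum_congr rfl fun P _ =>
    sum_qBin_mul_qBin (hq ▸ Fintype.one_lt_card) hρ2, Finset.sum_boole, Finset.filter_filter,
    Nat.card_eq_fintype_card, Fintype.card_subtype]
  congr 2
  ext P
  simp only [Finset.mem_filter, Finset.mem_univ, true_and]
  tauto
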